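/- arXiv:2602.06888 — 4 statements merged into one kernel-verified Lean document; each statement's English description precedes it below -/
import Mathlib

section
/- If C₁ and C₂ are disjoint embedded circles in the real projective plane ℝP², then at most one of them is nonseparating; that is, the complements ℝP² \ C₁ and ℝP² \ C₂ are not both connected. -/
/-- Nonzero vectors of `ℝ³`. -/
def NonzeroVec3 : Type := {v : Fin 3 → ℝ // v ≠ 0}

instance : TopologicalSpace NonzeroVec3 :=
  inferInstanceAs (TopologicalSpace {v : Fin 3 → ℝ // v ≠ 0})

/-- The setoid identifying nonzero vectors of `ℝ³` up to nonzero scalar. -/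
def projSetoid : Setoid NonzeroVec3 where
  r v w := ∃ c : ℝ, c ≠ 0 ∧ w.val = c • v.val
  iseqv := by
    constructor
    · exact fun v => ⟨1, one_ne_zero, (one_smul ℝ v.val).symm⟩
    · rintro v w ⟨c, hc, h⟩
      exact ⟨c⁻¹, inv_ne_zero hc, by rw [h, smul_smul, inv_mul_cancel₀ hc, one_smul]⟩
    · rintro u v w ⟨c, hc, h⟩ ⟨c', hc', h'⟩
      exact ⟨c' * c, mul_ne_zero hc' hc, by rw [h', h, smul_smul]⟩

/-- The real projective plane `ℝP²`, i.e. the projectivization of `ℝ³`,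
equipped with the quotient topology. -/
def RP2 : Type := Quotient projSetoid

instance : TopologicalSpace RP2 :=
  inferInstanceAs (TopologicalSpace (Quotient projSetoid))

/-- A subset `C ⊆ ℝP²` is an embedded circle if it is homeomorphic to the circle `S¹`. -/
def IsEmbeddedCircle (C : Set RP2) : Prop :=
  Nonempty (↥C ≃ₜ Circle)

open Complex Topology ComplexConjugate

/-- If a continuous function has constant exponential near a point, it is constant near it. -/
theorem eventually_eq_of_exp_eq {X : Type*} [TopologicalSpace X] {g : X → ℂ} {x : X}
    (hg : ContinuousAt g x) (h : ∀ᶠ y in 𝓝 x, exp (g y) = exp (g x)) :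
    ∀ᶠ y in 𝓝 x, g y = g x := by
  have hb : ∀ᶠ y in 𝓝 x, dist (g y) (g x) < 1 := hg.eventually (Metric.ball_mem_nhds _ one_pos)
  filter_upwards [h, hb] with y hy hd
  have hnorm : |(g y - g x).im| < 1 := (abs_im_le_norm _).trans_lt (by rwa [← dist_eq_norm])
  have hpi := Real.pi_gt_three
  have h1 : exp (g y - g x) = 1 := by rw [exp_sub, hy, div_self (exp_ne_zero _)]
  have h2 := log_exp (x := g y - g x) (by linarith [(abs_lt.1 hnorm).1])
    (by linarith [(abs_lt.1 hnorm).2])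
  rw [h1, log_one] at h2
  exact (sub_eq_zero.1 h2.symm)

/-- A continuous function on a preconnected space with constant exponential is constant. -/
theorem eq_of_exp_eq {X : Type*} [TopologicalSpace X] [PreconnectedSpace X] {g : X → ℂ}
    (hg : Continuous g) (h : ∀ x y, exp (g x) = exp (g y)) (x y : X) : g x = g y :=
  IsLocallyConstant.apply_eq_of_preconnectedSpace
    ((IsLocallyConstant.iff_eventually_eq g).2 fun x =>
      eventually_eq_of_exp_eq hg.continuousAt (Filter.Eventually.of_forall fun y => h y x)) x y

/-- A function with a simple zero at `p` has no continuous logarithm around `p`. -/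
theorem not_exists_log_near_zero {H : ℂ → ℂ} {p : ℂ} (hH : Continuous H) (hp : H p ≠ 0)
    {l : ℂ → ℂ} (hl : ContinuousOn l {z | (z - p) * H z ≠ 0})
    (hexp : ∀ z, (z - p) * H z ≠ 0 → exp (l z) = (z - p) * H z) : False := by
  have hev : ∀ᶠ z in 𝓝 p, H z / H p ∈ slitPlane := by
    have : ContinuousAt (fun z => H z / H p) p := (hH.div_const _).continuousAt
    refine this.eventually (isOpen_slitPlane.mem_nhds ?_)
    change H p / H p ∈ slitPlane
    rw [div_self hp]
    exact one_mem_slitPlane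
  obtain ⟨ε, hε, hball⟩ := Metric.eventually_nhds_iff.1 hev
  set r : ℝ := ε / 2 with hr
  have hr0 : 0 < r := by positivity
  have hrC : (r : ℂ) ≠ 0 := by exact_mod_cast hr0.ne'
  let c : ℝ → ℂ := fun θ => p + r * exp (θ * I)
  have hc : Continuous c := by fun_prop
  have hslit : ∀ θ, H (c θ) / H p ∈ slitPlane := fun θ => hball (by
    simp only [c, dist_eq_norm, add_sub_cancel_left, norm_mul, norm_exp_ofReal_mul_I, mul_one,
      norm_real, Real.norm_eq_abs, abs_of_pos hr0]
    linarith)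
  have hne : ∀ θ, H (c θ) ≠ 0 := fun θ h0 => slitPlane_ne_zero (hslit θ) (by simp [h0])
  have hcp : ∀ θ, c θ - p = r * exp (θ * I) := fun θ => by simp [c]
  have hne' : ∀ θ, (c θ - p) * H (c θ) ≠ 0 := fun θ =>
    mul_ne_zero (by rw [hcp]; exact mul_ne_zero hrC (exp_ne_zero _)) (hne θ)
  let m : ℝ → ℂ := fun θ => l (c θ) - log (H (c θ) / H p) - θ * I
  have hm : Continuous m := by
    refine (Continuous.sub ?_ ?_).sub (by fun_prop)
    · exact hl.comp_continuous hc hne'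
    · exact ((hH.comp hc).div_const _).clog hslit
  have hmexp : ∀ θ, exp (m θ) = r * H p := fun θ => by
    simp only [m]
    rw [exp_sub, exp_sub, exp_log (slitPlane_ne_zero (hslit θ)), hexp _ (hne' θ), hcp]
    have := hne θ
    have := exp_ne_zero (θ * I)
    field_simp
  have h := eq_of_exp_eq hm (fun x y => by rw [hmexp, hmexp]) (2 * Real.pi) 0
  have hcc : c (2 * Real.pi) = c 0 := by simp [c]
  simp only [m, hcc] at h
  have : (2 * Real.pi * I : ℂ) = 0 := by
    push_cast at h
    linear_combination -h
  exact two_pi_I_ne_zero this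

/-- The unit sphere of `ℂ × ℝ`, a model of the two-sphere. -/
abbrev UnitSphere : Type := {v : ℂ × ℝ // normSq v.1 + v.2 ^ 2 = 1}

namespace UnitSphere

instance : Neg UnitSphere := ⟨fun x => ⟨-x.1, by simpa using x.2⟩⟩

@[simp] theorem neg_val (x : UnitSphere) : (-x).1 = -x.1 := rfl

theorem neg_neg' (x : UnitSphere) : - -x = x := Subtype.ext (by simp)

theorem continuous_neg : Continuous fun x : UnitSphere => -x :=
  (continuous_subtype_val.neg).subtype_mk _

theorem mul_conj_val (x : UnitSphere) : x.1.1 * conj x.1.1 = (1 - x.1.2) * (1 + x.1.2) := by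
  have h := x.2
  rw [mul_conj]
  have : normSq x.1.1 = (1 - x.1.2) * (1 + x.1.2) := by linarith
  rw [this]; push_cast; ring

theorem neg_ne (x : UnitSphere) : -x ≠ x := by
  intro h
  have h1 := congrArg (fun y : UnitSphere => y.1.1) h
  have h2 := congrArg (fun y : UnitSphere => y.1.2) h
  simp only [neg_val, Prod.fst_neg, Prod.snd_neg, neg_eq_self] at h1 h2
  have := x.2
  simp [h1, h2] at this

/-- Stereographic projection from `(0, 1)`. -/
noncomputable def stereo (x : UnitSphere) : ℂ := x.1.1 / (1 - x.1.2)

/-- Inverse stereographic projection. -/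
noncomputable def invStereo (z : ℂ) : UnitSphere :=
  ⟨((2 / (1 + normSq z) : ℝ) * z, (normSq z - 1) / (1 + normSq z)), by
    have h : (1 + normSq z) ≠ 0 := by have := normSq_nonneg z; positivity
    simp only [normSq_mul, normSq_ofReal]
    field_simp
    ring⟩

theorem continuous_invStereo : Continuous invStereo := by
  have h : ∀ z : ℂ, (1 + normSq z) ≠ 0 := fun z => by have := normSq_nonneg z; positivity
  have hn : Continuous fun z : ℂ => normSq z := continuous_normSq
  refine Continuous.subtype_mk (Continuous.prodMk ?_ ?_) _
  · exact (continuous_ofReal.comp (continuous_const.div (by fun_prop) h)).mul continuous_id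
  · exact (by fun_prop : Continuous fun z : ℂ => normSq z - 1).div (by fun_prop) h

theorem invStereo_stereo {x : UnitSphere} (hx : x.1.2 ≠ 1) : invStereo (stereo x) = x := by
  have h1 : (1 - x.1.2) ≠ 0 := sub_ne_zero.2 hx.symm
  have hn : normSq (stereo x) = (1 + x.1.2) / (1 - x.1.2) := by
    have : (1 - x.1.2 : ℂ) = ((1 - x.1.2 : ℝ) : ℂ) := by push_cast; rfl
    rw [stereo, normSq_div, this, normSq_ofReal]
    have := x.2
    field_simp
    linarith
  have h2 : (1 + (1 + x.1.2) / (1 - x.1.2)) = 2 / (1 - x.1.2) := by field_simp; ring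
  have h1' : (1 - x.1.2 : ℂ) ≠ 0 := by exact_mod_cast h1
  refine Subtype.ext (Prod.ext ?_ ?_)
  · simp only [invStereo, hn, h2]
    push_cast
    rw [stereo]
    field_simp
  · simp only [invStereo, hn, h2]
    field_simp
    ring

theorem stereo_inj {x y : UnitSphere} (hx : x.1.2 ≠ 1) (hy : y.1.2 ≠ 1)
    (h : stereo x = stereo y) : x = y := by
  rw [← invStereo_stereo hx, ← invStereo_stereo hy, h]

/-- On the sphere, this agrees up to a positive factor with `(ζ - a) * conj (ζ - q)`, where `ζ` is
the stereographic coordinate; unlike that expression it extends to the centre of projection. -/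
noncomputable def pairing (a q : ℂ) (z : UnitSphere) : ℂ :=
  (1 + z.1.2) - a * conj z.1.1 - conj q * z.1.1 + a * conj q * (1 - z.1.2)

theorem pairing_mul (a q : ℂ) (z : UnitSphere) :
    pairing a q z * (1 - z.1.2) =
      (z.1.1 - a * (1 - z.1.2)) * conj (z.1.1 - q * (1 - z.1.2)) := by
  have h := mul_conj_val z
  simp only [pairing, map_sub, map_mul, map_one, conj_ofReal]
  linear_combination -h

theorem pairing_of_snd_eq_one (a q : ℂ) {z : UnitSphere} (hz : z.1.2 = 1) :
    pairing a q z = 2 := by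
  have h := z.2
  rw [hz] at h
  have h0 : z.1.1 = 0 := normSq_eq_zero.1 (by linarith)
  simp [pairing, hz, h0]
  norm_num

theorem pairing_eq_zero_iff {P Q : UnitSphere} (hP : P.1.2 ≠ 1) (hQ : Q.1.2 ≠ 1)
    (z : UnitSphere) : pairing (stereo P) (stereo Q) z = 0 ↔ z = P ∨ z = Q := by
  by_cases hz : z.1.2 = 1
  · rw [pairing_of_snd_eq_one _ _ hz]
    refine iff_of_false two_ne_zero ?_
    rintro (rfl | rfl) <;> contradiction
  have h1 : (1 - z.1.2 : ℂ) ≠ 0 := by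
    rw [sub_ne_zero]; exact_mod_cast Ne.symm hz
  have key : ∀ R : UnitSphere, R.1.2 ≠ 1 → (z.1.1 - stereo R * (1 - z.1.2) = 0 ↔ z = R) := by
    intro R hR
    rw [sub_eq_zero, ← div_eq_iff h1]
    exact ⟨fun h => stereo_inj hz hR h, fun h => by rw [h]; rfl⟩
  rw [← mul_left_inj' h1, zero_mul, pairing_mul, mul_eq_zero, map_eq_zero, key P hP, key Q hQ]

theorem pairing_self_mem_slitPlane {a : ℂ} {z : UnitSphere} (h : pairing a a z ≠ 0) :
    pairing a a z ∈ slitPlane := by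
  by_cases hz : z.1.2 = 1
  · rw [pairing_of_snd_eq_one _ _ hz]; exact ofNat_mem_slitPlane 2
  have hlt : 0 < 1 - z.1.2 := by
    have h1 := z.2
    have h2 := normSq_nonneg z.1.1
    have : z.1.2 < 1 := lt_of_le_of_ne (by nlinarith) hz
    linarith
  have hm := pairing_mul a a z
  rw [mul_conj] at hm
  have h1 : ((1 - z.1.2 : ℝ) : ℂ) ≠ 0 := by exact_mod_cast hlt.ne'
  have e : pairing a a z = ((normSq (z.1.1 - a * (1 - z.1.2)) / (1 - z.1.2) : ℝ) : ℂ) := by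
    push_cast at h1 ⊢
    rw [eq_div_iff h1, hm]
  rw [e] at h ⊢
  rw [ofReal_mem_slitPlane]
  refine lt_of_le_of_ne (div_nonneg (normSq_nonneg _) hlt.le) fun h0 => h (by rw [← h0]; simp)

theorem pairing_antipode_neg {P : UnitSphere} (h1 : P.1.2 ≠ 1) (h2 : P.1.2 ≠ -1)
    (z : UnitSphere) : pairing (stereo P) (stereo (-P)) (-z) =
      -pairing (stereo P) (stereo (-P)) z := by
  have a1 : (1 - P.1.2 : ℂ) ≠ 0 := by rw [sub_ne_zero]; exact_mod_cast h1.symm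
  have a2 : (1 + P.1.2 : ℂ) ≠ 0 := by
    intro h
    have : (1 + P.1.2 : ℝ) = 0 := by exact_mod_cast h
    exact h2 (by linarith)
  have hPP : stereo P * conj (stereo (-P)) = -1 := by
    have := mul_conj_val P
    simp only [stereo, neg_val, Prod.fst_neg, Prod.snd_neg, map_div₀, map_neg, map_one,
      conj_ofReal, ofReal_neg, sub_neg_eq_add, map_add]
    field_simp
    linear_combination -this
  simp only [pairing, hPP, neg_val, Prod.fst_neg, Prod.snd_neg, map_neg, ofReal_neg]
  ring

theorem pairing_invStereo (a q z : ℂ) :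
    pairing a q (invStereo z) = (z - a) * ((2 / (1 + normSq z) : ℝ) * conj (z - q)) := by
  have h : (1 + normSq z : ℝ) ≠ 0 := by have := normSq_nonneg z; positivity
  have h' : (1 + normSq z : ℂ) ≠ 0 := by exact_mod_cast h
  have hz := mul_conj z
  simp only [pairing, invStereo, map_mul, conj_ofReal, map_sub]
  push_cast
  field_simp
  linear_combination (-2) * hz

theorem continuous_pairing : Continuous fun x : (ℂ × ℂ) × UnitSphere =>
    pairing x.1.1 x.1.2 x.2 := by
  unfold pairing
  have h1 : Continuous fun x : (ℂ × ℂ) × UnitSphere => x.2.1.1 := by fun_prop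
  have h2 : Continuous fun x : (ℂ × ℂ) × UnitSphere => (x.2.1.2 : ℂ) :=
    continuous_ofReal.comp (by fun_prop)
  have h3 := continuous_conj.comp h1
  have h4 : Continuous fun x : (ℂ × ℂ) × UnitSphere => conj x.1.2 :=
    continuous_conj.comp (by fun_prop)
  have h5 : Continuous fun x : (ℂ × ℂ) × UnitSphere => x.1.1 := by fun_prop
  exact (((continuous_const.add h2).sub (h5.mul h3)).sub (h4.mul h1)).add
    ((h5.mul h4).mul (continuous_const.sub h2))

theorem continuous_pairing_left (a q : ℂ) : Continuous (pairing a q) :=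
  continuous_pairing.comp (by fun_prop : Continuous fun z : UnitSphere => ((a, q), z))

/-- Off a path avoiding the centre of projection, the pairing with its end points has a
continuous logarithm. -/
theorem exists_log_pairing (α : C(unitInterval, UnitSphere)) (hα : ∀ t, (α t).1.2 ≠ 1) :
    ∃ l : UnitSphere → ℂ, ContinuousOn l {z | ∀ t, z ≠ α t} ∧
      ∀ z, (∀ t, z ≠ α t) → exp (l z) = pairing (stereo (α 1)) (stereo (α 0)) z := by
  have hA : Continuous fun t : unitInterval => stereo (α t) := by
    unfold stereo
    refine Continuous.div (by fun_prop) (continuous_const.sub (continuous_ofReal.comp (by fun_prop)))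
      fun t => ?_
    rw [sub_ne_zero]; exact_mod_cast (hα t).symm
  let W := {z : UnitSphere // ∀ t, z ≠ α t}
  have hne : ∀ (t : unitInterval) (z : W),
      pairing (stereo (α t)) (stereo (α 0)) z.1 ≠ 0 := fun t z => by
    rw [Ne, pairing_eq_zero_iff (hα t) (hα 0)]
    rintro (h | h)
    · exact z.2 t h
    · exact z.2 0 h
  let H : C(unitInterval × W, {w : ℂ // w ≠ 0}) :=
    ⟨fun x => ⟨pairing (stereo (α x.1)) (stereo (α 0)) x.2.1, hne x.1 x.2⟩, by
      refine Continuous.subtype_mk ?_ _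
      exact continuous_pairing.comp (((hA.comp continuous_fst).prodMk continuous_const).prodMk
        (continuous_subtype_val.comp continuous_snd))⟩
  let f : C(W, ℂ) := ⟨fun z => log (pairing (stereo (α 0)) (stereo (α 0)) z.1),
    ((continuous_pairing_left _ _).comp continuous_subtype_val).clog
      fun z => pairing_self_mem_slitPlane (hne 0 z)⟩
  have H0 : ∀ z, H (0, z) = ⟨exp (f z), exp_ne_zero _⟩ := fun z =>
    Subtype.ext (exp_log (hne 0 z)).symm
  let G := isCoveringMap_exp.liftHomotopy H f H0
  have hG : ∀ z : W, exp (G (1, z)) = pairing (stereo (α 1)) (stereo (α 0)) z.1 := fun z =>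
    congrArg Subtype.val (congrFun (isCoveringMap_exp.liftHomotopy_lifts H f H0) (1, z))
  classical
  refine ⟨fun z => if h : ∀ t, z ≠ α t then G (1, ⟨z, h⟩) else 0, ?_, fun z hz => ?_⟩
  · rw [continuousOn_iff_continuous_domRestrict]
    have : Continuous fun z : W => G (1, z) := by fun_prop
    refine this.congr fun z => ?_
    rw [Set.domRestrict_apply, dif_pos z.2]
  · simp only [dif_pos hz]
    exact hG ⟨z, hz⟩

/-- Two paths joining antipodal points cannot avoid each other and each other's antipodes. -/
theorem antipodal_paths_meet (α δ : C(unitInterval, UnitSphere)) (hα : α 1 = -α 0) (hδ : δ 1 = -δ 0)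
    (hpole : ∀ t, (α t).1.2 ≠ 1) (h : ∀ s t, δ s ≠ α t) (h' : ∀ s t, -δ s ≠ α t) : False := by
  obtain ⟨l, hl, hexp⟩ := exists_log_pairing α hpole
  have hodd := pairing_antipode_neg (P := α 1) (hpole 1) (by
    have := hpole 0
    rw [hα]
    simpa using this)
  have h0 : -α 1 = α 0 := by rw [hα, neg_neg']
  rw [h0] at hodd
  let c : unitInterval → ℂ := fun t => l (-δ t) - l (δ t)
  have hc : Continuous c :=
    (hl.comp_continuous (continuous_neg.comp δ.continuous) h').sub (hl.comp_continuous δ.continuous h)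
  have hce : ∀ t, exp (c t) = -1 := fun t => by
    have hne : exp (l (δ t)) ≠ 0 := exp_ne_zero _
    rw [exp_sub, hexp _ (h' t), hodd, ← hexp _ (h t), neg_div, div_self hne]
  have h01 := eq_of_exp_eq hc (fun s t => by rw [hce, hce]) 0 1
  simp only [c, hδ, neg_neg'] at h01
  have hzero : c 0 = 0 := by simp only [c]; linear_combination h01 / 2
  have := hce 0
  rw [hzero, exp_zero] at this
  norm_num at this

/-- The product of the pairing and its antipodal translate has no continuous logarithm off its
zeros. -/
theorem not_exists_log_pairing_mul {P Q : UnitSphere} (hP : P.1.2 ≠ 1) (hQ : Q.1.2 ≠ 1)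
    (hPQ : P ≠ Q) (hPQ' : -P ≠ Q) {l : UnitSphere → ℂ}
    (hl : ContinuousOn l
      {z | pairing (stereo P) (stereo Q) z * pairing (stereo P) (stereo Q) (-z) ≠ 0})
    (hexp : ∀ z, pairing (stereo P) (stereo Q) z * pairing (stereo P) (stereo Q) (-z) ≠ 0 →
      exp (l z) = pairing (stereo P) (stereo Q) z * pairing (stereo P) (stereo Q) (-z)) :
    False := by
  set p := stereo P with hp
  set q := stereo Q with hq
  let H : ℂ → ℂ := fun z => (2 / (1 + normSq z) : ℝ) * conj (z - q) * pairing p q (-invStereo z)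
  have hden : ∀ z : ℂ, (1 + normSq z) ≠ 0 := fun z => by have := normSq_nonneg z; positivity
  have hHeq : ∀ z, (z - p) * H z = pairing p q (invStereo z) * pairing p q (-invStereo z) := by
    intro z
    rw [pairing_invStereo]
    simp only [H]
    ring
  refine not_exists_log_near_zero (H := H) (p := p) (l := l ∘ invStereo) ?_ ?_ ?_ ?_
  · refine Continuous.mul (Continuous.mul ?_ ?_) ?_
    · exact continuous_ofReal.comp
        (continuous_const.div (continuous_const.add continuous_normSq) hden)
    · exact continuous_conj.comp (by fun_prop)
    · exact (continuous_pairing_left p q).comp (continuous_neg.comp continuous_invStereo)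
  · refine mul_ne_zero (mul_ne_zero ?_ ?_) ?_
    · exact_mod_cast div_ne_zero two_ne_zero (hden p)
    · rw [Ne, map_eq_zero, sub_eq_zero]
      exact fun h => hPQ (stereo_inj hP hQ h)
    · rw [hp, invStereo_stereo hP, Ne, pairing_eq_zero_iff hP hQ]
      rintro (h | h)
      · exact neg_ne P h
      · exact hPQ' h
  · refine hl.comp continuous_invStereo.continuousOn fun z hz => ?_
    simpa only [Set.mem_ofPred_eq, hHeq] using hz
  · intro z hz
    rw [hHeq] at hz ⊢
    exact hexp _ hz

instance : MulAction ℤˣ UnitSphere where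
  smul u x := if u = 1 then x else -x
  one_smul _ := if_pos rfl
  mul_smul u v x := by
    change (if u * v = 1 then x else -x) =
      if u = 1 then (if v = 1 then x else -x) else -(if v = 1 then x else -x)
    rcases Int.units_eq_one_or u with rfl | rfl <;> rcases Int.units_eq_one_or v with rfl | rfl <;>
      simp [neg_neg']

theorem neg_one_smul (x : UnitSphere) : (-1 : ℤˣ) • x = -x := if_neg (by decide)

variable {X : Type*} [TopologicalSpace X] {p : UnitSphere → X}

/-- A quotient map identifying exactly the antipodal points is a quotient covering map. -/
theorem isQuotientCoveringMap_of_isQuotientMap (hq : IsQuotientMap p)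
    (h : ∀ x y, p x = p y ↔ x = y ∨ x = -y) : IsQuotientCoveringMap p ℤˣ where
  __ := hq
  continuous_const_smul u := by
    rcases Int.units_eq_one_or u with rfl | rfl
    · simpa only [one_smul] using continuous_id'
    · simpa only [neg_one_smul] using continuous_neg
  apply_eq_iff_mem_orbit {x y} := by
    rw [h, MulAction.mem_orbit_iff]
    constructor
    · rintro (rfl | rfl)
      · exact ⟨1, one_smul _ _⟩
      · exact ⟨-1, neg_one_smul _⟩
    · rintro ⟨u, rfl⟩
      rcases Int.units_eq_one_or u with rfl | rfl
      · exact .inl (one_smul _ _)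
      · exact .inr (neg_one_smul _)
  disjoint e := by
    let b : UnitSphere → ℝ := fun y => y.1.1.re * e.1.1.re + y.1.1.im * e.1.1.im + y.1.2 * e.1.2
    have hb : Continuous b := by
      have h1 : Continuous fun y : UnitSphere => y.1.1.re :=
        continuous_re.comp (by fun_prop)
      have h2 : Continuous fun y : UnitSphere => y.1.1.im :=
        continuous_im.comp (by fun_prop)
      fun_prop
    have hbe : 0 < b e := by
      have := e.2
      rw [normSq_apply] at this
      simp only [b]
      nlinarith
    refine ⟨{y | 0 < b y}, (isOpen_lt continuous_const hb).mem_nhds hbe, fun u hu => ?_⟩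
    rcases Int.units_eq_one_or u with rfl | rfl
    · rfl
    · obtain ⟨_, ⟨y, hy, rfl⟩, hy'⟩ := hu
      have hneg : b (-y) = -b y := by simp [b]; ring
      simp only [neg_one_smul, Set.mem_ofPred_eq, hneg] at hy hy'
      linarith

variable (hp : IsQuotientCoveringMap p ℤˣ)
include hp

theorem map_eq_iff {x y : UnitSphere} : p x = p y ↔ x = y ∨ x = -y := by
  rw [hp.apply_eq_iff_mem_orbit, MulAction.mem_orbit_iff]
  constructor
  · rintro ⟨u, rfl⟩
    rcases Int.units_eq_one_or u with rfl | rfl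
    · exact .inl (one_smul _ _)
    · exact .inr (neg_one_smul _)
  · rintro (rfl | rfl)
    · exact ⟨1, one_smul _ _⟩
    · exact ⟨-1, neg_one_smul _⟩

theorem map_neg (x : UnitSphere) : p (-x) = p x := (map_eq_iff hp).2 (.inr rfl)

/-- A circle in the base lifts to a path on the sphere. -/
theorem exists_lift_circle {C : Set X} (e : C ≃ₜ Circle) :
    ∃ γ : C(unitInterval, UnitSphere), (Set.range fun t => p (γ t)) = C ∧
      (∀ s t, p (γ s) = p (γ t) → s = t ∨ (s = 0 ∧ t = 1) ∨ (s = 1 ∧ t = 0)) ∧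
      p (γ 1) = p (γ 0) := by
  let c : C(unitInterval, X) := ⟨fun t => e.symm (Circle.exp (2 * Real.pi * t)), by fun_prop⟩
  obtain ⟨x, hx⟩ := hp.surjective (c 0)
  obtain ⟨γ, hγ, -⟩ := hp.isCoveringMap.exists_path_lifts c x hx.symm
  have hγ' : ∀ t, p (γ t) = c t := congrFun hγ
  have hpi := Real.pi_pos
  refine ⟨γ, ?_, fun s t h => ?_, ?_⟩
  · simp only [hγ']
    refine Set.Subset.antisymm ?_ fun y hy => ?_
    · rintro _ ⟨t, rfl⟩
      exact (e.symm _).2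
    · obtain ⟨θ, hθ, he⟩ := Circle.periodic_exp.exists_mem_Ico₀ Real.two_pi_pos
        (arg (e ⟨y, hy⟩ : ℂ))
      rw [Circle.exp_arg] at he
      refine ⟨⟨θ / (2 * Real.pi), div_nonneg hθ.1 (by positivity),
        (div_le_one (by positivity)).2 hθ.2.le⟩, ?_⟩
      have : 2 * Real.pi * (θ / (2 * Real.pi)) = θ := by field_simp
      simp only [c, ContinuousMap.coe_mk, this, ← he, Homeomorph.symm_apply_apply]
  · rw [hγ', hγ'] at h
    obtain ⟨m, hm⟩ := Circle.exp_eq_exp.1 (e.symm.injective (Subtype.ext h))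
    have hst : (s : ℝ) = t + m := by
      have : 2 * Real.pi * ((s : ℝ) - t - m) = 0 := by linarith
      rcases mul_eq_zero.1 this with h | h
      · linarith
      · linarith
    have s0 := s.2.1
    have s1 := s.2.2
    have t0 := t.2.1
    have t1 := t.2.2
    have hm1 : m ≤ 1 := by exact_mod_cast (by linarith : (m : ℝ) ≤ 1)
    have hm2 : -1 ≤ m := by exact_mod_cast (by linarith : (-1 : ℝ) ≤ m)
    obtain rfl | rfl | rfl : m = -1 ∨ m = 0 ∨ m = 1 := by omega
    · push_cast at hst
      exact .inr (.inl ⟨Subtype.ext (by change (s : ℝ) = 0; linarith),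
        Subtype.ext (by change (t : ℝ) = 1; linarith)⟩)
    · exact .inl (Subtype.ext (by simpa using hst))
    · push_cast at hst
      exact .inr (.inr ⟨Subtype.ext (by change (s : ℝ) = 1; linarith),
        Subtype.ext (by change (t : ℝ) = 0; linarith)⟩)
  · rw [hγ', hγ']
    simp [c]

/-- An embedded circle in the base is closed. -/
theorem isClosed_of_circle {C : Set X} (e : C ≃ₜ Circle) : IsClosed C := by
  obtain ⟨γ, hγ, -⟩ := exists_lift_circle hp e
  rw [← hp.isClosed_preimage]
  have hcl : IsClosed (Set.range γ) := (isCompact_range γ.continuous).isClosed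
  have : p ⁻¹' C = Set.range γ ∪ (fun x => -x) ⁻¹' Set.range γ := by
    ext x
    rw [← hγ]
    constructor
    · rintro ⟨t, ht⟩
      rcases (map_eq_iff hp).1 ht with h | h
      · exact .inl ⟨t, h⟩
      · exact .inr ⟨t, h⟩
    · rintro (⟨t, h⟩ | ⟨t, h⟩)
      · exact ⟨t, by simp only [h]⟩
      · exact ⟨t, by simp only [h, map_neg hp]⟩
  rw [this]
  exact hcl.union (hcl.preimage continuous_neg)

omit hp

/-- The points which, together with their antipodes, do not lie on a path. -/
def offPath (α : C(unitInterval, UnitSphere)) : Set UnitSphere :=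
  {z | (∀ t, z ≠ α t) ∧ ∀ t, -z ≠ α t}

theorem isOpen_offPath (α : C(unitInterval, UnitSphere)) : IsOpen (offPath α) := by
  have h : IsOpen (Set.range α)ᶜ := (isCompact_range α.continuous).isClosed.isOpen_compl
  convert! h.inter (h.preimage continuous_neg) using 1
  ext z
  simp [offPath, eq_comm]

/-- The symmetrized pairing with the end points of a path has an antipodally invariant logarithm
off the path and its antipode. -/
theorem exists_symm_log_pairing (α : C(unitInterval, UnitSphere)) (hα : ∀ t, (α t).1.2 ≠ 1) :
    ∃ l : UnitSphere → ℂ, ContinuousOn l (offPath α) ∧ (∀ z, l (-z) = l z) ∧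
      ∀ z ∈ offPath α, exp (l z) = pairing (stereo (α 1)) (stereo (α 0)) z *
        pairing (stereo (α 1)) (stereo (α 0)) (-z) := by
  obtain ⟨l, hl, hexp⟩ := exists_log_pairing α hα
  refine ⟨fun z => l z + l (-z), ?_, fun z => by simp only [neg_neg', add_comm], fun z hz => ?_⟩
  · exact (hl.mono fun z hz => hz.1).add
      (hl.comp continuous_neg.continuousOn fun z hz => hz.2)
  · rw [exp_add, hexp z hz.1, hexp (-z) hz.2]

include hp

/-- A simple closed curve in the base that lifts to a closed curve separates. -/
theorem not_isPreconnected_compl_of_closed_lift {γ : C(unitInterval, UnitSphere)}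
    (hinj : ∀ s t, p (γ s) = p (γ t) → s = t ∨ (s = 0 ∧ t = 1) ∨ (s = 1 ∧ t = 0))
    (hclosed : γ 1 = γ 0) (hpole : ∀ t, (γ t).1.2 ≠ 1)
    (hne : (Set.range fun t => p (γ t))ᶜ.Nonempty) :
    ¬ IsPreconnected (Set.range fun t => p (γ t))ᶜ := by
  intro hconn
  let half : unitInterval := ⟨1 / 2, by norm_num, by norm_num⟩
  let u : C(unitInterval, unitInterval) :=
    ⟨fun t => ⟨t / 2, by linarith [t.2.1], by linarith [t.2.2]⟩, by fun_prop⟩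
  let v : C(unitInterval, unitInterval) :=
    ⟨fun t => ⟨1 - t / 2, by linarith [t.2.2], by linarith [t.2.1]⟩, by fun_prop⟩
  have hu0 : γ (u 0) = γ 0 := congrArg γ (Subtype.ext (by simp [u]))
  have hu1 : γ (u 1) = γ half := congrArg γ (Subtype.ext (by simp [u, half]))
  have hv0 : γ (v 0) = γ 0 := by
    rw [← hclosed]; exact congrArg γ (Subtype.ext (by simp [v]))
  have hv1 : γ (v 1) = γ half := congrArg γ (Subtype.ext (by norm_num [v, half]))
  obtain ⟨l₁, hl₁, hs₁, he₁⟩ := exists_symm_log_pairing (γ.comp u) fun t => hpole _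
  obtain ⟨l₂, hl₂, hs₂, he₂⟩ := exists_symm_log_pairing (γ.comp v) fun t => hpole _
  simp only [ContinuousMap.comp_apply, hu0, hu1, hv0, hv1] at he₁ he₂
  set U₁ := offPath (γ.comp u)
  set U₂ := offPath (γ.comp v)
  have ho₁ : IsOpen U₁ := isOpen_offPath _
  have ho₂ : IsOpen U₂ := isOpen_offPath _
  have hW : ∀ z, p z ∈ (Set.range fun t => p (γ t))ᶜ ↔ z ∈ U₁ ∩ U₂ := by
    intro z
    constructor
    · intro hz
      have h : ∀ t, z ≠ γ t ∧ -z ≠ γ t := fun t =>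
        ⟨fun h => hz ⟨t, by simp only [← h]⟩, fun h => hz ⟨t, by simp only [← h, map_neg hp]⟩⟩
      exact ⟨⟨fun t => (h _).1, fun t => (h _).2⟩, ⟨fun t => (h _).1, fun t => (h _).2⟩⟩
    · rintro ⟨⟨h1, h1'⟩, ⟨h2, h2'⟩⟩ ⟨t, ht⟩
      have key : ∃ s, t = u s ∨ t = v s := by
        rcases le_total (t : ℝ) (1 / 2) with h | h
        · exact ⟨⟨2 * t, by linarith [t.2.1], by linarith⟩, .inl (Subtype.ext (by simp [u]))⟩
        · exact ⟨⟨2 * (1 - t), by linarith [t.2.2], by linarith⟩,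
            .inr (Subtype.ext (by simp [v]))⟩
      obtain ⟨s, rfl | rfl⟩ := key <;> rcases (map_eq_iff hp).1 ht with h | h
      · exact h1 s h.symm
      · exact h1' s h.symm
      · exact h2 s h.symm
      · exact h2' s h.symm
  obtain ⟨y₀, hy₀⟩ := hne
  obtain ⟨z₀, rfl⟩ := hp.surjective y₀
  let g : UnitSphere → ℂ := fun z => l₁ z - l₂ z
  have hg : ContinuousOn g (U₁ ∩ U₂) :=
    (hl₁.mono Set.inter_subset_left).sub (hl₂.mono Set.inter_subset_right)
  have hgexp : ∀ z ∈ U₁ ∩ U₂, exp (g z) = 1 := fun z hz => by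
    rw [exp_sub, he₁ z hz.1, ← he₂ z hz.2, div_self (exp_ne_zero _)]
  have hloc : ∀ z ∈ U₁ ∩ U₂, ∀ᶠ y in 𝓝 z, y ∈ U₁ ∩ U₂ ∧ g y = g z := fun z hz => by
    have hnhds := (ho₁.inter ho₂).mem_nhds hz
    refine Filter.Eventually.and hnhds (eventually_eq_of_exp_eq (hg.continuousAt hnhds) ?_)
    filter_upwards [hnhds] with y hy
    rw [hgexp y hy, hgexp z hz]
  have hconst : ∀ z ∈ U₁ ∩ U₂, g z = g z₀ := by
    by_contra! hcon
    obtain ⟨z₁, hz₁, hne₁⟩ := hcon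
    have hO : ∀ S : Set ℂ, IsOpen (p '' {z | z ∈ U₁ ∩ U₂ ∧ g z ∈ S}) := fun S => by
      refine hp.isCoveringMap.isOpenMap _ (isOpen_iff_eventually.2 fun z hz => ?_)
      filter_upwards [hloc z hz.1] with y hy
      exact ⟨hy.1, by rw [hy.2]; exact hz.2⟩
    obtain ⟨_, -, ⟨a, ha, rfl⟩, ⟨b, hb, hab⟩⟩ := hconn _ _ (hO {g z₀}) (hO {g z₀}ᶜ)
      (fun y hy => by
        obtain ⟨z, rfl⟩ := hp.surjective y
        by_cases h : g z = g z₀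
        · exact .inl ⟨z, ⟨(hW z).1 hy, h⟩, rfl⟩
        · exact .inr ⟨z, ⟨(hW z).1 hy, h⟩, rfl⟩)
      ⟨p z₀, hy₀, z₀, ⟨(hW z₀).1 hy₀, rfl⟩, rfl⟩
      ⟨p z₁, (hW z₁).2 hz₁, z₁, ⟨hz₁, hne₁⟩, rfl⟩
    have hgab : g b = g a := by
      rcases (map_eq_iff hp).1 hab with rfl | rfl
      · rfl
      · simp only [g, hs₁, hs₂]
    exact hb.2 (by rw [hgab]; exact ha.2)
  have hexp₀ := hgexp z₀ ((hW z₀).1 hy₀)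
  classical
  let l : UnitSphere → ℂ := fun z => if z ∈ U₁ then l₁ z else l₂ z + g z₀
  have hle₁ : ∀ z ∈ U₁, l z = l₁ z := fun z hz => if_pos hz
  have hle₂ : ∀ z ∈ U₂, l z = l₂ z + g z₀ := fun z hz => by
    by_cases h : z ∈ U₁
    · rw [hle₁ z h, ← hconst z ⟨h, hz⟩]
      simp only [g]
      ring
    · exact if_neg h
  have hcover : ∀ z, pairing (stereo (γ half)) (stereo (γ 0)) z *
      pairing (stereo (γ half)) (stereo (γ 0)) (-z) ≠ 0 → z ∈ U₁ ∨ z ∈ U₂ := by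
    intro z hz
    rw [mul_ne_zero_iff, Ne, Ne, pairing_eq_zero_iff (hpole _) (hpole _),
      pairing_eq_zero_iff (hpole _) (hpole _), not_or, not_or] at hz
    obtain ⟨⟨hz1, hz2⟩, hz3, hz4⟩ := hz
    by_contra! hcon
    have hmem : ∀ w : C(unitInterval, unitInterval), z ∉ offPath (γ.comp w) →
        ∃ t, (z = γ (w t) ∨ -z = γ (w t)) := fun w hw => by
      by_contra! h
      exact hw ⟨fun t => (h t).1, fun t => (h t).2⟩
    obtain ⟨s, hs⟩ := hmem u hcon.1
    obtain ⟨t, ht⟩ := hmem v hcon.2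
    have hps : p (γ (u s)) = p z := by
      rcases hs with h | h <;> rw [← h]
      exact map_neg hp z
    have hpt : p (γ (v t)) = p z := by
      rcases ht with h | h <;> rw [← h]
      exact map_neg hp z
    have hnot : u s ≠ half ∧ u s ≠ 0 ∧ u s ≠ 1 := by
      refine ⟨fun h => ?_, fun h => ?_, fun h => ?_⟩ <;> rw [h] at hs
      · tauto
      · tauto
      · rw [hclosed] at hs; tauto
    rcases hinj _ _ (hps.trans hpt.symm) with h | h | h
    · have h' : (s : ℝ) / 2 = 1 - t / 2 := congrArg Subtype.val h
      refine hnot.1 (Subtype.ext ?_)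
      change (s : ℝ) / 2 = 1 / 2
      linarith [s.2.2, t.2.2]
    · exact hnot.2.1 h.1
    · exact hnot.2.2 h.1
  have hP0 : p (γ half) ≠ p (γ 0) := fun h => by
    have h0 : half ≠ 0 := fun h => by simpa [half] using congrArg Subtype.val h
    have h1 : half ≠ 1 := fun h => by simpa [half] using congrArg Subtype.val h
    rcases hinj _ _ h with h | h | h
    · exact h0 h
    · exact h0 h.1
    · exact h1 h.1
  refine not_exists_log_pairing_mul (P := γ half) (Q := γ 0) (l := l) (hpole _) (hpole _)
    (fun h => hP0 (by rw [h])) (fun h => hP0 (by rw [← h, map_neg hp])) ?_ ?_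
  · intro z hz
    refine ContinuousAt.continuousWithinAt ?_
    rcases hcover z hz with h | h
    · refine (hl₁.continuousAt (ho₁.mem_nhds h)).congr ?_
      filter_upwards [ho₁.mem_nhds h] with y hy using (hle₁ y hy).symm
    · have hc : ContinuousAt (fun y => l₂ y + g z₀) z :=
        (hl₂.continuousAt (ho₂.mem_nhds h)).add continuousAt_const
      refine hc.congr ?_
      filter_upwards [ho₂.mem_nhds h] with y hy using (hle₂ y hy).symm
  · intro z hz
    rcases hcover z hz with h | h
    · rw [hle₁ z h, he₁ z h]
    · rw [hle₂ z h, exp_add, hexp₀, mul_one, he₂ z h]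

/-- A nonseparating circle contains the image of a path joining antipodal points. -/
theorem exists_antipodal_path {C : Set X} (e : C ≃ₜ Circle) (hC : IsConnected Cᶜ)
    (hpole : ∀ z : UnitSphere, z.1.2 = 1 → p z ∉ C) :
    ∃ γ : C(unitInterval, UnitSphere), (∀ t, p (γ t) ∈ C) ∧ γ 1 = -γ 0 := by
  obtain ⟨γ, hγ, hinj, h10⟩ := exists_lift_circle hp e
  have hmem : ∀ t, p (γ t) ∈ C := fun t => hγ ▸ ⟨t, rfl⟩
  refine ⟨γ, hmem, ((map_eq_iff hp).1 h10).resolve_left fun hclosed => ?_⟩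
  subst hγ
  exact not_isPreconnected_compl_of_closed_lift hp hinj hclosed (fun t h => hpole _ h (hmem t))
    hC.nonempty hC.isPreconnected

end UnitSphere

instance : PreconnectedSpace RP2 := by
  have h : IsConnected ({0}ᶜ : Set (Fin 3 → ℝ)) :=
    isConnected_compl_singleton_of_one_lt_rank (by rw [rank_fin_fun]; norm_num) 0
  have : PreconnectedSpace NonzeroVec3 := isPreconnected_iff_preconnectedSpace.1 h.isPreconnected
  have hq : IsQuotientMap (Quotient.mk projSetoid : NonzeroVec3 → RP2) := isQuotientMap_quotient_mk'
  exact hq.surjective.denseRange.preconnectedSpace hq.continuous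

/-- The sphere covers the projective plane, and the pole can be placed over any given point. -/
theorem exists_isQuotientCoveringMap_RP2 (w : RP2) :
    ∃ p : UnitSphere → RP2, IsQuotientCoveringMap p ℤˣ ∧ ∀ z : UnitSphere, z.1.2 = 1 → p z = w := by
  obtain ⟨v, rfl⟩ := Quotient.exists_rep w
  have hfin : Module.finrank ℝ (ℂ × ℝ) = Module.finrank ℝ (Fin 3 → ℝ) := by
    simp [Module.finrank_prod, Complex.finrank_real_complex]
  let B : (ℂ × ℝ) ≃L[ℝ] (Fin 3 → ℝ) := ContinuousLinearEquiv.ofFinrankEq hfin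
  obtain ⟨A, hA⟩ := SeparatingDual.exists_continuousLinearEquiv_apply_eq (R := ℝ)
    (x := B (0, 1)) (y := v.1) (by simp) v.2
  let T : (ℂ × ℝ) ≃L[ℝ] (Fin 3 → ℝ) := B.trans A
  have hT : T (0, 1) = v.1 := hA
  have hne : ∀ x : UnitSphere, T x.1 ≠ 0 := fun x h => by
    have h0 : x.1 = 0 := by simpa using h
    simpa [h0] using x.2
  let f : UnitSphere → NonzeroVec3 := fun x => ⟨T x.1, hne x⟩
  have hf : Continuous f := (T.continuous.comp continuous_subtype_val).subtype_mk _
  let q : NonzeroVec3 → RP2 := Quotient.mk projSetoid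
  have hq : IsQuotientMap q := isQuotientMap_quotient_mk'
  let N : NonzeroVec3 → ℝ := fun u => normSq (T.symm u.1).1 + (T.symm u.1).2 ^ 2
  have hN : Continuous N := by
    have h : Continuous fun u : NonzeroVec3 => T.symm u.1 :=
      T.symm.continuous.comp continuous_subtype_val
    exact (continuous_normSq.comp h.fst).add (h.snd.pow 2)
  have hNpos : ∀ u, 0 < N u := fun u => by
    have h0 : T.symm u.1 ≠ 0 := by simpa using u.2
    have h1 := normSq_nonneg (T.symm u.1).1
    rcases eq_or_ne (T.symm u.1).1 0 with h | h
    · have : (T.symm u.1).2 ≠ 0 := fun h' => h0 (Prod.ext h h')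
      simp only [N]
      positivity
    · have := normSq_pos.2 h
      simp only [N]
      positivity
  let r : NonzeroVec3 → UnitSphere := fun u => ⟨(Real.sqrt (N u))⁻¹ • T.symm u.1, by
    have hs := Real.sq_sqrt (hNpos u).le
    have hs0 : Real.sqrt (N u) ≠ 0 := (Real.sqrt_pos.2 (hNpos u)).ne'
    simp only [Prod.smul_fst, Prod.smul_snd, real_smul, normSq_mul, normSq_ofReal, smul_eq_mul]
    field_simp
    rw [hs]⟩
  have hr : Continuous r := by
    have h1 : Continuous fun u => (Real.sqrt (N u))⁻¹ :=
      hN.sqrt.inv₀ fun u => (Real.sqrt_pos.2 (hNpos u)).ne'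
    have h2 : Continuous fun u : NonzeroVec3 => T.symm u.1 :=
      T.symm.continuous.comp continuous_subtype_val
    exact (h1.smul h2).subtype_mk _
  have hqfr : (q ∘ f) ∘ r = q := by
    funext u
    have hs0 : Real.sqrt (N u) ≠ 0 := (Real.sqrt_pos.2 (hNpos u)).ne'
    exact Quotient.sound ⟨Real.sqrt (N u), hs0, by simp [f, r, smul_smul, hs0]⟩
  have hquot : IsQuotientMap (q ∘ f) :=
    IsQuotientMap.of_comp hr (hq.continuous.comp hf) (hqfr.symm ▸ hq)
  refine ⟨q ∘ f, UnitSphere.isQuotientCoveringMap_of_isQuotientMap hquot fun x y => ?_, ?_⟩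
  · constructor
    · intro h
      obtain ⟨c, -, hc⟩ := Quotient.exact h
      have hxy : y.1 = c • x.1 := T.injective (by simpa [f] using hc)
      have hx := x.2
      have hy := y.2
      rw [hxy] at hy
      simp only [Prod.smul_fst, Prod.smul_snd, real_smul, normSq_mul, normSq_ofReal,
        smul_eq_mul] at hy
      have hcc : c * c = 1 := by linear_combination hy - c * c * hx
      rcases mul_self_eq_one_iff.1 hcc with rfl | rfl
      · exact .inl (Subtype.ext (by rw [hxy, one_smul]))
      · exact .inr (Subtype.ext (by rw [UnitSphere.neg_val, hxy]; simp))
    · rintro (rfl | rfl)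
      · rfl
      · exact Quotient.sound ⟨-1, by norm_num, by simp [f]⟩
  · intro z hz
    have h0 : z.1.1 = 0 := normSq_eq_zero.1 (by have := z.2; rw [hz] at this; linarith)
    have hz1 : z.1 = (0, 1) := Prod.ext h0 hz
    exact congrArg q (Subtype.ext (by simp only [f, hz1, hT]))

/-- Two disjoint embedded circles in `ℝP²` cannot both be nonseparating: their
complements are not both connected. -/
theorem not_both_nonseparating_of_disjoint_circles (C₁ C₂ : Set RP2)
    (h₁ : IsEmbeddedCircle C₁) (h₂ : IsEmbeddedCircle C₂) (hdisj : Disjoint C₁ C₂) :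
    ¬ (IsConnected C₁ᶜ ∧ IsConnected C₂ᶜ) := by
  rintro ⟨hc₁, hc₂⟩
  obtain ⟨e₁⟩ := h₁
  obtain ⟨e₂⟩ := h₂
  have hw : ∃ w, w ∉ C₁ ∪ C₂ := by
    obtain ⟨p₀, hp₀, -⟩ := exists_isQuotientCoveringMap_RP2 hc₁.nonempty.some
    by_contra! hcover
    obtain ⟨x, -, hx₁, hx₂⟩ := isPreconnected_closed_iff.1
      (PreconnectedSpace.isPreconnected_univ (α := RP2)) C₁ C₂
      (UnitSphere.isClosed_of_circle hp₀ e₁) (UnitSphere.isClosed_of_circle hp₀ e₂)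
      (fun w _ => hcover w) ⟨e₁.symm 1, trivial, (e₁.symm 1).2⟩ ⟨e₂.symm 1, trivial, (e₂.symm 1).2⟩
    exact Set.disjoint_left.1 hdisj hx₁ hx₂
  obtain ⟨w, hw⟩ := hw
  obtain ⟨p, hp, hpole⟩ := exists_isQuotientCoveringMap_RP2 w
  obtain ⟨α, hα, hα'⟩ := UnitSphere.exists_antipodal_path hp e₁ hc₁ fun z hz h =>
    hw (.inl (hpole z hz ▸ h))
  obtain ⟨δ, hδ, hδ'⟩ := UnitSphere.exists_antipodal_path hp e₂ hc₂ fun z hz h =>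
    hw (.inr (hpole z hz ▸ h))
  refine UnitSphere.antipodal_paths_meet α δ hα' hδ' (fun t h => hw (.inl (hpole _ h ▸ hα t)))
    (fun s t h => ?_) fun s t h => ?_
  · exact Set.disjoint_left.1 hdisj (hα t) (h ▸ hδ s)
  · exact Set.disjoint_left.1 hdisj (hα t) (h ▸ (UnitSphere.map_neg hp (δ s)).symm ▸ hδ s)
end

section
/- Let t, u, v, w ∈ ℤ² be four distinct points in convex position forming a convex quadrilateral whose diagonals are the segments [u,v] and [t,w], and suppose that the triangles {t,u,v} and {u,v,w} are both unimodular. Then the images of t, u, v, w under the reduction map ℤ² → (ℤ/2ℤ)² are exactly the four elements of (ℤ/2ℤ)². -/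
/-- `2·(signed area)` of the lattice triangle with vertices `u`, `v`, `w`,
i.e. `det(v-u, w-u)`. -/
def det2 (u v w : ℤ × ℤ) : ℤ :=
  (v.1 - u.1) * (w.2 - u.2) - (v.2 - u.2) * (w.1 - u.1)

/-- The reduction map `ℤ² → (ℤ/2ℤ)²` recording the parity class of a lattice point. -/
def par (p : ℤ × ℤ) : ZMod 2 × ZMod 2 := ((p.1 : ZMod 2), (p.2 : ZMod 2))

/-- A convex lattice quadrilateral cut by a diagonal into two unimodular triangles is a
parallelogram. -/
theorem add_eq_add_of_unimodular_circuit (t u v w : ℤ × ℤ)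
    (hdiag₁ : det2 u v t * det2 u v w < 0)
    (hdiag₂ : det2 t w u * det2 t w v < 0)
    (htri₁ : det2 t u v = 1 ∨ det2 t u v = -1)
    (htri₂ : det2 u v w = 1 ∨ det2 u v w = -1) :
    t + w = u + v := by
  have cyc : det2 u v t = det2 t u v := by unfold det2; ring
  rw [cyc] at hdiag₁
  have sum₁ : det2 t u v + det2 u v w = 0 := by
    rcases htri₁ with h | h <;> rcases htri₂ with h' | h' <;> rw [h, h'] at hdiag₁ ⊢ <;> omega
  have diff : det2 t w u - det2 t w v = det2 u v w - det2 t u v := by unfold det2; ring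
  have sum₂ : det2 t w u + det2 t w v = 0 := by
    rcases mul_neg_iff.mp hdiag₂ with h | h <;> omega
  have ne : det2 u v w - det2 t u v ≠ 0 := by omega
  unfold det2 at sum₁ sum₂ ne
  refine Prod.ext (sub_eq_zero.mp ?_) (sub_eq_zero.mp ?_) <;>
    refine (mul_eq_zero.mp ?_).resolve_left ne <;> simp only [Prod.fst_add, Prod.snd_add]
  · linear_combination (w.1 - t.1) * sum₁ + (v.1 - u.1) * sum₂
  · linear_combination (w.2 - t.2) * sum₁ + (v.2 - u.2) * sum₂

/-- The vertices of a nondegenerate triangle in `(ℤ/2ℤ)²`, together with the point completing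
them to a parallelogram, exhaust the plane. -/
theorem zmod_two_parallelogram_eq_univ : ∀ u v w : ZMod 2 × ZMod 2,
    (v.1 - u.1) * (w.2 - u.2) - (v.2 - u.2) * (w.1 - u.1) = 1 →
    ∀ x, x = u + v - w ∨ x = u ∨ x = v ∨ x = w := by
  decide

/-- Let `t,u,v,w` be four distinct lattice points in convex position forming a convex
quadrilateral with diagonals `[u,v]` and `[t,w]` (encoded by the strict opposite-side
conditions on determinants), such that the triangles `{t,u,v}` and `{u,v,w}` are
unimodular.  Then `t,u,v,w` realize all four parity classes of `(ℤ/2ℤ)²`. -/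
theorem parities_of_unimodular_circuit (t u v w : ℤ × ℤ)
    (hdist : t ≠ u ∧ t ≠ v ∧ t ≠ w ∧ u ≠ v ∧ u ≠ w ∧ v ≠ w)
    (hdiag₁ : det2 u v t * det2 u v w < 0)
    (hdiag₂ : det2 t w u * det2 t w v < 0)
    (htri₁ : det2 t u v = 1 ∨ det2 t u v = -1)
    (htri₂ : det2 u v w = 1 ∨ det2 u v w = -1) :
    ({par t, par u, par v, par w} : Set (ZMod 2 × ZMod 2)) = Set.univ := by
  have hpar := add_eq_add_of_unimodular_circuit t u v w hdiag₁ hdiag₂ htri₁ htri₂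
  have ht : par t = par u + par v - par w := by
    rw [eq_sub_of_add_eq hpar]
    simp [par]
  have hdet : ((det2 u v w : ℤ) : ZMod 2) = 1 := by
    rcases htri₂ with h | h <;> rw [h] <;> decide
  refine Set.eq_univ_of_forall fun x => ?_
  simp only [Set.mem_insert_iff, Set.mem_singleton_iff, ht]
  refine zmod_two_parallelogram_eq_univ _ _ _ ?_ x
  simpa [det2, par] using hdet
end

section
/- Let t, u, v, w ∈ ℤ² be four distinct points in convex position forming a convex quadrilateral whose diagonals are the segments [u,v] and [t,w], with the triangles {t,u,v} and {u,v,w} both unimodular. Let σ : ℤ² → 𝔽₂ satisfy the bridge pattern σ(t) = σ(w) ≠ σ(u) = σ(v). Then for every (a,b) ∈ 𝔽₂ × 𝔽₂ with (a,b) ≠ (0,0), the sign distribution τ(i,j) = σ(i,j) + a·(i mod 2) + b·(j mod 2) does not satisfy τ(t) = τ(w) ≠ τ(u) = τ(v). Consequently, among the four sign distributions obtained from σ in the four quadrants via the extension rules σ(−i,j) = σ(i,j) + i, σ(i,−j) = σ(i,j) + j, σ(−i,−j) = σ(i,j) + i + j, the bridge pattern on the circuit t,u,v,w occurs in exactly one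 quadrant. -/
/-- The bridge sign pattern `σ(t) = σ(w) ≠ σ(u) = σ(v)` on the circuit `t,u,v,w`. -/
def BridgePattern (σ : ℤ × ℤ → ZMod 2) (t u v w : ℤ × ℤ) : Prop :=
  σ t = σ w ∧ σ u = σ v ∧ σ t ≠ σ u

/-- The sign distribution seen in the quadrant labelled by `(a,b) ∈ 𝔽₂ × 𝔽₂` via the
extension rules `σ(-i,j) = σ(i,j) + i`, `σ(i,-j) = σ(i,j) + j`,
`σ(-i,-j) = σ(i,j) + i + j`: namely `τ(i,j) = σ(i,j) + a·i + b·j (mod 2)`. -/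
def quadrantShift (a b : ZMod 2) (σ : ℤ × ℤ → ZMod 2) : ℤ × ℤ → ZMod 2 :=
  fun p => σ p + a * (p.1 : ZMod 2) + b * (p.2 : ZMod 2)

/-- A linear form over a commutative ring that is constant on the vertices of a triangle whose
determinant is a unit vanishes identically. -/
theorem linear_form_eq_zero_of_const_on_triangle {R : Type*} [CommRing R] {a b : R}
    {t u v : ℤ × ℤ} (hdet : IsUnit ((det2 t u v : ℤ) : R))
    (htu : a * (t.1 : R) + b * (t.2 : R) = a * (u.1 : R) + b * (u.2 : R))
    (huv : a * (u.1 : R) + b * (u.2 : R) = a * (v.1 : R) + b * (v.2 : R)) :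
    a = 0 ∧ b = 0 := by
  rw [← hdet.mul_left_eq_zero (a := a), ← hdet.mul_left_eq_zero (a := b)]
  simp only [det2]
  push_cast
  constructor
  · linear_combination (-((v.2 : R) - t.2) + (u.2 - t.2)) * htu + ((u.2 : R) - t.2) * huv
  · linear_combination (-((u.1 : R) - t.1) + (v.1 - t.1)) * htu - ((u.1 : R) - t.1) * huv

theorem zmod_two_eq_of_ne_of_add_ne :
    ∀ {x y p q : ZMod 2}, x ≠ y → x + p ≠ y + q → p = q := by
  decide

theorem eq_zero_of_bridgePattern_quadrantShift {t u v w : ℤ × ℤ} {σ : ℤ × ℤ → ZMod 2}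
    {a b : ZMod 2} (hdet : IsUnit (det2 t u v)) (hσ : BridgePattern σ t u v w)
    (hτ : BridgePattern (quadrantShift a b σ) t u v w) : a = 0 ∧ b = 0 := by
  obtain ⟨-, huv, htu⟩ := hσ
  obtain ⟨-, huv', htu'⟩ := hτ
  simp only [quadrantShift, add_assoc] at huv' htu'
  refine linear_form_eq_zero_of_const_on_triangle (t := t) (u := u) (v := v)
    (hdet.map (Int.castRingHom (ZMod 2))) (zmod_two_eq_of_ne_of_add_ne htu htu') ?_
  rw [huv] at huv'
  exact add_left_cancel huv'

/-- Let `t,u,v,w` be four distinct lattice points in convex position forming a convex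
quadrilateral with diagonals `[u,v]` and `[t,w]` (encoded by the strict opposite-side
determinant conditions), with the triangles `{t,u,v}` and `{u,v,w}` unimodular, and
let `σ` satisfy the bridge pattern `σ(t) = σ(w) ≠ σ(u) = σ(v)`.  Then no nontrivial
parity shift `τ(i,j) = σ(i,j) + a·i + b·j` satisfies the bridge pattern; consequently
among the four quadrants the bridge pattern on the circuit occurs exactly once. -/
theorem bridge_pattern_unique_quadrant (t u v w : ℤ × ℤ)
    (hdist : t ≠ u ∧ t ≠ v ∧ t ≠ w ∧ u ≠ v ∧ u ≠ w ∧ v ≠ w)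
    (hdiag₁ : det2 u v t * det2 u v w < 0)
    (hdiag₂ : det2 t w u * det2 t w v < 0)
    (htri₁ : det2 t u v = 1 ∨ det2 t u v = -1)
    (htri₂ : det2 u v w = 1 ∨ det2 u v w = -1)
    (σ : ℤ × ℤ → ZMod 2) (hσ : BridgePattern σ t u v w) :
    (∀ a b : ZMod 2, (a, b) ≠ ((0 : ZMod 2), (0 : ZMod 2)) →
      ¬ BridgePattern (quadrantShift a b σ) t u v w) ∧
    (∃! ab : ZMod 2 × ZMod 2, BridgePattern (quadrantShift ab.1 ab.2 σ) t u v w) := by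
  have key : ∀ a b : ZMod 2, BridgePattern (quadrantShift a b σ) t u v w → a = 0 ∧ b = 0 :=
    fun _ _ => eq_zero_of_bridgePattern_quadrantShift (Int.isUnit_iff.2 htri₁) hσ
  refine ⟨fun a b hab hτ => hab (Prod.ext_iff.2 (key a b hτ)), (0, 0), ?_,
    fun ab hτ => Prod.ext_iff.2 (key ab.1 ab.2 hτ)⟩
  simpa [BridgePattern, quadrantShift] using hσ
end

section
/- Let d ≥ 3 and let σ : A(d) → 𝔽₂ be a sign distribution such that for every quadrangle Q_e spanned by an interior edge e of the honeycomb triangulation H_d that lies entirely in A(d), exactly one of the four vertices of Q_e carries a σ-value different from the σ-values of the other three. Then there exist a, b, c ∈ 𝔽₂ such that σ(i,j) = (i+1)(j+1) + a·i + b·j + c (mod 2) for all (i,j) ∈ A(d); in other words, σ is equivalent to the Harnack sign distribution. -/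
/-- Lattice points of the dilated standard triangle `d·Δ₂`. -/
def trianglePts (d : ℕ) : Set (ℤ × ℤ) :=
  {p | 0 ≤ p.1 ∧ 0 ≤ p.2 ∧ p.1 + p.2 ≤ (d : ℤ)}

/-- Exactly one of the four values `x₁, x₂, x₃, x₄ ∈ 𝔽₂` differs from the other three. -/
def OneDiffers (x₁ x₂ x₃ x₄ : ZMod 2) : Prop :=
  (x₁ ≠ x₂ ∧ x₂ = x₃ ∧ x₃ = x₄) ∨ (x₂ ≠ x₁ ∧ x₁ = x₃ ∧ x₃ = x₄) ∨
  (x₃ ≠ x₁ ∧ x₁ = x₂ ∧ x₂ = x₄) ∨ (x₄ ≠ x₁ ∧ x₁ = x₂ ∧ x₂ = x₃)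

theorem OneDiffers.sum_eq_one {x₁ x₂ x₃ x₄ : ZMod 2} (h : OneDiffers x₁ x₂ x₃ x₄) :
    x₁ + x₂ + x₃ + x₄ = 1 := by
  unfold OneDiffers at h
  revert x₁ x₂ x₃ x₄
  decide

/-- On the lattice triangle of size `d`, a function whose vertical differences are invariant under
the unit step to the right and under the diagonal step has constant vertical differences. -/
theorem vertical_diff_const {G : Type*} [AddCommGroup G] {d : ℕ} {f : ℕ → ℕ → G}
    (hright : ∀ x y, x + y + 2 ≤ d → f (x + 1) (y + 1) - f (x + 1) y = f x (y + 1) - f x y)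
    (hdiag : ∀ x y, x + y + 2 ≤ d → f x (y + 2) - f x (y + 1) = f (x + 1) (y + 1) - f (x + 1) y)
    (x y : ℕ) (h : x + y + 1 ≤ d) : f x (y + 1) - f x y = f 0 1 - f 0 0 := by
  induction y generalizing x with
  | zero =>
    induction x with
    | zero => rfl
    | succ x ih => rw [hright x 0 (by omega), ih (by omega)]
  | succ y ih => rw [hdiag x y (by omega), ih (x + 1) (by omega)]

/-- A function on the lattice triangle of size `d` whose horizontal and vertical differences are
constant is affine. -/
theorem eq_affine_of_diff_const {G : Type*} [AddCommGroup G] {d : ℕ} {f : ℕ → ℕ → G} {a b : G}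
    (ha : ∀ x y, x + y + 1 ≤ d → f (x + 1) y - f x y = a)
    (hb : ∀ x y, x + y + 1 ≤ d → f x (y + 1) - f x y = b)
    (x y : ℕ) (h : x + y ≤ d) : f x y = x • a + y • b + f 0 0 := by
  induction y with
  | zero =>
    induction x with
    | zero => simp
    | succ x ih =>
      rw [sub_eq_iff_eq_add.1 (ha x 0 (by omega)), ih (by omega), succ_nsmul]
      abel
  | succ y ih =>
    rw [sub_eq_iff_eq_add.1 (hb x y (by omega)), ih (by omega), succ_nsmul]
    abel

/-- Suppose `d ≥ 3` and `σ` is a sign distribution on `A(d)` such that for every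
quadrangle spanned by an interior edge of the honeycomb triangulation `H_d` lying
entirely in `A(d)` (the unit square of a diagonal edge, and the two parallelogram
quadrangles of horizontal and vertical edges), exactly one of the four vertices
carries a `σ`-value different from the other three.  Then
`σ(i,j) = (i+1)(j+1) + a·i + b·j + c (mod 2)` for some `a,b,c ∈ 𝔽₂`, i.e. `σ` is
equivalent to the Harnack sign distribution. -/
theorem harnack_signs_of_oneDiffers (d : ℕ) (hd : 3 ≤ d) (σ : ℤ × ℤ → ZMod 2)
    (hdiag : ∀ x y : ℤ,
      ({(x, y), (x + 1, y), (x, y + 1), (x + 1, y + 1)} : Set (ℤ × ℤ)) ⊆ trianglePts d →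
      OneDiffers (σ (x, y)) (σ (x + 1, y)) (σ (x, y + 1)) (σ (x + 1, y + 1)))
    (hhor : ∀ x y : ℤ,
      ({(x, y + 1), (x, y), (x + 1, y), (x + 1, y - 1)} : Set (ℤ × ℤ)) ⊆ trianglePts d →
      OneDiffers (σ (x, y + 1)) (σ (x, y)) (σ (x + 1, y)) (σ (x + 1, y - 1)))
    (hver : ∀ x y : ℤ,
      ({(x + 1, y), (x, y), (x, y + 1), (x - 1, y + 1)} : Set (ℤ × ℤ)) ⊆ trianglePts d →
      OneDiffers (σ (x + 1, y)) (σ (x, y)) (σ (x, y + 1)) (σ (x - 1, y + 1))) :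
    ∃ a b c : ZMod 2, ∀ p ∈ trianglePts d,
      σ p = ((p.1 : ZMod 2) + 1) * ((p.2 : ZMod 2) + 1)
        + a * (p.1 : ZMod 2) + b * (p.2 : ZMod 2) + c := by
  have two : (2 : ZMod 2) = 0 := rfl
  let f : ℕ → ℕ → ZMod 2 := fun x y => σ (x, y) - ((x : ZMod 2) + 1) * ((y : ZMod 2) + 1)
  have square (x y : ℕ) (h : x + y + 2 ≤ d) :
      σ (x, y) + σ (x + 1, y) + σ (x, y + 1) + σ (x + 1, y + 1) = 1 := by
    refine (hdiag x y ?_).sum_eq_one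
    simp only [Set.insert_subset_iff, Set.singleton_subset_iff, trianglePts, Set.mem_ofPred_eq]
    omega
  have horizontal (x y : ℕ) (h : x + y + 2 ≤ d) :
      σ (x, y + 2) + σ (x, y + 1) + σ (x + 1, y + 1) + σ (x + 1, y) = 1 := by
    have key := (hhor x (y + 1) ?_).sum_eq_one
    · rwa [add_sub_cancel_right, add_assoc (y : ℤ), one_add_one_eq_two] at key
    simp only [Set.insert_subset_iff, Set.singleton_subset_iff, trianglePts, Set.mem_ofPred_eq]
    omega
  have vertical (x y : ℕ) (h : x + y + 2 ≤ d) :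
      σ (x + 2, y) + σ (x + 1, y) + σ (x + 1, y + 1) + σ (x, y + 1) = 1 := by
    have key := (hver (x + 1) y ?_).sum_eq_one
    · rwa [add_sub_cancel_right, add_assoc (x : ℤ), one_add_one_eq_two] at key
    simp only [Set.insert_subset_iff, Set.singleton_subset_iff, trianglePts, Set.mem_ofPred_eq]
    omega
  have hv := vertical_diff_const (d := d) (f := f)
    (fun x y h => by
      have := square x y h
      simp only [f]
      push_cast
      linear_combination this - (σ (x + 1, y) + σ (x, y + 1)) * two)
    (fun x y h => by
      have := horizontal x y h
      simp only [f]
      push_cast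
      linear_combination this + (1 - σ (x, y + 1) - σ (x + 1, y + 1)) * two)
  have hh := vertical_diff_const (d := d) (f := fun y x => f x y)
    (fun y x h => by
      have := square x y (by omega)
      simp only [f]
      push_cast
      linear_combination this - (σ (x + 1, y) + σ (x, y + 1)) * two)
    (fun y x h => by
      have := vertical x y (by omega)
      simp only [f]
      push_cast
      linear_combination this + (1 - σ (x + 1, y) - σ (x + 1, y + 1)) * two)
  refine ⟨f 1 0 - f 0 0, f 0 1 - f 0 0, f 0 0, ?_⟩
  rintro ⟨i, j⟩ ⟨hi, hj, hij⟩
  dsimp only at hi hj hij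
  lift i to ℕ using hi
  lift j to ℕ using hj
  have key := eq_affine_of_diff_const (d := d) (f := f) (fun x y h => hh y x (by omega)) hv i j
    (by exact_mod_cast hij)
  rw [sub_eq_iff_eq_add, nsmul_eq_mul, nsmul_eq_mul] at key
  push_cast
  rw [key]
  ring
end
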